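/- For any proper 3-systems P^(1) and P^(2), there exists a proper 3-system P such that K(P) is the convex hull of K(P^(1)) ∪ K(P^(2)). -/

import Mathlib

open Filter Set Pointwise Topology

noncomputable section

/-- Points of `ℝ^n`. -/
abbrev RVec (n : ℕ) := Fin n → ℝ

/-- The vector of `ℝ^n` with a `1` in position `j` (0-based) and `0` elsewhere;
`eVec n 0` is the first canonical basis vector `e_1`. -/
def eVec (n : ℕ) (j : ℕ) : RVec n := fun i => if (i : ℕ) = j then 1 else 0

/-- `P` is an `n`-system on the subinterval `I` of `[0,∞)`:
`I` is an order-connected subset of `[0,∞)` with nonempty interior, and conditions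
(S1), (S2), (S3) hold at every `q ∈ I`. -/
def IsNSystem (n : ℕ) (I : Set ℝ) (P : ℝ → RVec n) : Prop :=
  I ⊆ Set.Ici (0 : ℝ) ∧ I.OrdConnected ∧ (interior I).Nonempty ∧
  ∀ q ∈ I,
    ((∀ i, 0 ≤ P q i) ∧ Monotone (P q) ∧ (∑ i, P q i) = q) ∧
    ∃ ε > (0 : ℝ), ∃ k ℓ : Fin n,
      (∀ t ∈ I ∩ Set.Icc (q - ε) q, P t = P q + (t - q) • eVec n ℓ) ∧
      (∀ t ∈ I ∩ Set.Icc q (q + ε), P t = P q + (t - q) • eVec n k) ∧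
      (q ∈ interior I → ℓ < k → ∀ i : Fin n, ℓ ≤ i → i ≤ k → P q i = P q ℓ)

/-- `P` is a proper `n`-system on `I`: it is an `n`-system whose first component is
unbounded (by the monotonicity (S1) of the components, this is equivalent to all
components simultaneously exceeding any given bound). -/
def IsProperSys (n : ℕ) (I : Set ℝ) (P : ℝ → RVec n) : Prop :=
  IsNSystem n I P ∧ ∀ M : ℝ, ∃ q ∈ I, ∀ i, M < P q i

/-- The set `F(P)` of limits of `q_i⁻¹ • P(q_i)` along strictly increasing unbounded
sequences `(q_i)` in `I`. -/
def FSet (n : ℕ) (I : Set ℝ) (P : ℝ → RVec n) : Set (RVec n) :=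
  {x | ∃ q : ℕ → ℝ, (∀ i, q i ∈ I) ∧ StrictMono q ∧
    Tendsto q atTop atTop ∧ Tendsto (fun i => (q i)⁻¹ • P (q i)) atTop (𝓝 x)}

/-- The set `F(P, e₁)`: as `F(P)`, but with the extra requirement that the right
derivative of `P` at each `q_i` is the first basis vector `e_1`. -/
def FSetE1 (n : ℕ) (I : Set ℝ) (P : ℝ → RVec n) : Set (RVec n) :=
  {x | ∃ q : ℕ → ℝ, (∀ i, q i ∈ I) ∧ StrictMono q ∧ Tendsto q atTop atTop ∧
    (∀ i, ∃ ε > (0 : ℝ), ∀ t ∈ I ∩ Set.Icc (q i) (q i + ε),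
      P t = P (q i) + (t - q i) • eVec n 0) ∧
    Tendsto (fun i => (q i)⁻¹ • P (q i)) atTop (𝓝 x)}

/-- `q` is a switch number of the `n`-system `P` on `I`: a point of `I` on the boundary
of `I`, or an interior point where the local slopes `e_k` (right) and `e_ℓ` (left)
from (S2) satisfy `k < ℓ`. -/
def IsSwitchNumber (n : ℕ) (I : Set ℝ) (P : ℝ → RVec n) (q : ℝ) : Prop :=
  q ∈ I ∧ (q ∈ frontier I ∨
    (q ∈ interior I ∧ ∃ ε > (0 : ℝ), ∃ k ℓ : Fin n, k < ℓ ∧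
      (∀ t ∈ I ∩ Set.Icc (q - ε) q, P t = P q + (t - q) • eVec n ℓ) ∧
      (∀ t ∈ I ∩ Set.Icc q (q + ε), P t = P q + (t - q) • eVec n k)))

/-- `q` is a division number of the `n`-system `P` on `I`: a point of `I` on the boundary
of `I`, or an interior point where `P` is not differentiable, i.e. where the left and
right slopes from (S2) differ. -/
def IsDivisionNumber (n : ℕ) (I : Set ℝ) (P : ℝ → RVec n) (q : ℝ) : Prop :=
  q ∈ I ∧ (q ∈ frontier I ∨
    (q ∈ interior I ∧ ∃ ε > (0 : ℝ), ∃ k ℓ : Fin n, k ≠ ℓ ∧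
      (∀ t ∈ I ∩ Set.Icc (q - ε) q, P t = P q + (t - q) • eVec n ℓ) ∧
      (∀ t ∈ I ∩ Set.Icc q (q + ε), P t = P q + (t - q) • eVec n k)))

/-- A non-degenerate `n`-system: an `n`-system whose domain is a closed subinterval
of `(0,∞)` and whose switch points all have `n` distinct positive coordinates. -/
def IsNonDegenerate (n : ℕ) (I : Set ℝ) (P : ℝ → RVec n) : Prop :=
  IsNSystem n I P ∧ IsClosed I ∧ I ⊆ Set.Ioi (0 : ℝ) ∧
  ∀ q, IsSwitchNumber n I P q → (∀ i, 0 < P q i) ∧ StrictMono (P q)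

/-- A rigid `n`-system of mesh `δ`: a non-degenerate `n`-system whose switch points
belong to `δℤ^n`. -/
def IsRigid (n : ℕ) (δ : ℝ) (I : Set ℝ) (P : ℝ → RVec n) : Prop :=
  IsNonDegenerate n I P ∧
  ∀ q, IsSwitchNumber n I P q → ∀ i, ∃ m : ℤ, P q i = δ * m

/-- A self-similar system: the domain is unbounded and there is `ρ > 1` with
`P(ρq) = ρ • P(q)` for all `q` in the domain. -/
def IsSelfSimilar (n : ℕ) (I : Set ℝ) (P : ℝ → RVec n) : Prop :=
  ¬ BddAbove I ∧ ∃ ρ : ℝ, 1 < ρ ∧ ∀ q ∈ I, ρ * q ∈ I ∧ P (ρ * q) = ρ • P q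

/-- The cube `[-ε, ε]^n`. -/
def cubeNbhd (n : ℕ) (ε : ℝ) : Set (RVec n) := {y | ∀ i, |y i| ≤ ε}

/-- The distance `dist(E, F)`: the infimum of all `ε > 0` such that
`E ⊆ F + [-ε,ε]^n` and `F ⊆ E + [-ε,ε]^n`. -/
def cubeDist (n : ℕ) (E F : Set (RVec n)) : ℝ :=
  sInf {ε : ℝ | 0 < ε ∧ E ⊆ F + cubeNbhd n ε ∧ F ⊆ E + cubeNbhd n ε}

/-- `μ_T(P)`: the point of `ℝ^m` whose `j`-th coordinate is
`liminf_{q → ∞, q ∈ I} T_j(P(q))/q`. -/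
def muT (n m : ℕ) (T : RVec n → RVec m) (I : Set ℝ) (P : ℝ → RVec n) : RVec m :=
  fun j => Filter.liminf (fun q => T (P q) j / q) (atTop ⊓ 𝓟 I)

/-- `liminf` of a sequence of subsets of `ℝ^n`: the set of limits of convergent
sequences `(x_i)` with `x_i ∈ F i` for every `i`. -/
def setLiminf (n : ℕ) (F : ℕ → Set (RVec n)) : Set (RVec n) :=
  {x | ∃ y : ℕ → RVec n, (∀ i, y i ∈ F i) ∧ Tendsto y atTop (𝓝 x)}

/-- `limsup` of a sequence of subsets of `ℝ^n`: the set of accumulation points of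
sequences `(x_i)` with `x_i ∈ F i` for every `i`, i.e. limits of convergent
subsequences. -/
def setLimsup (n : ℕ) (F : ℕ → Set (RVec n)) : Set (RVec n) :=
  {x | ∃ (y : ℕ → RVec n) (φ : ℕ → ℕ), (∀ i, y i ∈ F i) ∧ StrictMono φ ∧
    Tendsto (y ∘ φ) atTop (𝓝 x)}

/-- `f` has left slope `e_ℓ` at `q`. -/
def SlopeL (f : ℝ → RVec 3) (q : ℝ) (ℓ : Fin 3) : Prop :=
  ∃ ε > (0 : ℝ), ∀ t ∈ Icc (q - ε) q, f t = f q + (t - q) • eVec 3 ℓ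

/-- `f` has right slope `e_k` at `q`. -/
def SlopeR (f : ℝ → RVec 3) (q : ℝ) (k : Fin 3) : Prop :=
  ∃ ε > (0 : ℝ), ∀ t ∈ Icc q (q + ε), f t = f q + (t - q) • eVec 3 k

/-- The conditions (S2) and (S3) at an interior point `q`; when the coordinates of `f q` are
increasing, (S3) amounts to `f q k ≤ f q ℓ`. -/
def Turn (f : ℝ → RVec 3) (q : ℝ) : Prop :=
  ∃ ℓ k, SlopeL f q ℓ ∧ SlopeR f q k ∧ f q k ≤ f q ℓ

/-- Condition (S1) for the point `v` at time `q`. -/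
def IsPosition (v : RVec 3) (q : ℝ) : Prop :=
  (∀ i, 0 ≤ v i) ∧ Monotone v ∧ ∑ i, v i = q

/-- `f` restricts to a proper `3`-system on a neighbourhood of `[T, ∞)`, with positive first
component. -/
structure IsTail (f : ℝ → RVec 3) (T : ℝ) : Prop where
  position : ∀ q, T ≤ q → IsPosition (f q) q
  turn : ∀ q, T ≤ q → Turn f q
  pos : ∀ q, T ≤ q → 0 < f q 0
  unbounded : ∀ M, ∃ q, T ≤ q ∧ M < f q 0

lemma eVec_apply (k i : Fin 3) : eVec 3 k i = if i = k then 1 else 0 := by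
  simp [eVec, Fin.ext_iff]

lemma sum_eVec (k : Fin 3) : ∑ i, eVec 3 k i = 1 := by
  simp [eVec_apply]

lemma eVec_nonneg (k i : Fin 3) : 0 ≤ eVec 3 k i := by
  rw [eVec_apply]; split_ifs <;> norm_num

lemma IsPosition.le₀₁ {v : RVec 3} {q : ℝ} (h : IsPosition v q) : v 0 ≤ v 1 :=
  h.2.1 (by decide)

lemma IsPosition.le₁₂ {v : RVec 3} {q : ℝ} (h : IsPosition v q) : v 1 ≤ v 2 :=
  h.2.1 (by decide)

lemma IsPosition.zero_le {v : RVec 3} {q : ℝ} (h : IsPosition v q) (i : Fin 3) : v 0 ≤ v i :=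
  h.2.1 (Fin.zero_le i)

lemma IsPosition.le_two {v : RVec 3} {q : ℝ} (h : IsPosition v q) (i : Fin 3) : v i ≤ v 2 :=
  h.2.1 (Fin.le_last i)

lemma IsPosition.sum_eq {v : RVec 3} {q : ℝ} (h : IsPosition v q) : v 0 + v 1 + v 2 = q := by
  rw [← h.2.2, Fin.sum_univ_three]

lemma SlopeR.shift {f : ℝ → RVec 3} {q : ℝ} {k : Fin 3} (h : SlopeR f q k) :
    ∃ ε > (0 : ℝ), ∀ x ∈ Ico q (q + ε), SlopeR f x k := by
  obtain ⟨ε, hε, h⟩ := h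
  refine ⟨ε, hε, fun x hx => ⟨q + ε - x, by linarith [hx.2], fun t ht => ?_⟩⟩
  rw [h t ⟨by linarith [hx.1, ht.1], by linarith [ht.2]⟩, h x ⟨hx.1, hx.2.le⟩, add_assoc, ← add_smul]
  congr 2; ring

lemma SlopeL.shift {f : ℝ → RVec 3} {q : ℝ} {k : Fin 3} (h : SlopeL f q k) :
    ∃ ε > (0 : ℝ), ∀ x ∈ Ico (q - ε) q, SlopeR f x k := by
  obtain ⟨ε, hε, h⟩ := h
  refine ⟨ε, hε, fun x hx => ⟨q - x, by linarith [hx.2], fun t ht => ?_⟩⟩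
  rw [h t ⟨by linarith [hx.1, ht.1], by linarith [ht.2]⟩, h x ⟨hx.1, hx.2.le⟩, add_assoc, ← add_smul]
  congr 2; ring

lemma SlopeR.unique {f : ℝ → RVec 3} {q : ℝ} {k k' : Fin 3} (h : SlopeR f q k)
    (h' : SlopeR f q k') : k = k' := by
  obtain ⟨ε, hε, h⟩ := h
  obtain ⟨ε', hε', h'⟩ := h'
  have hm : 0 < min ε ε' := lt_min hε hε'
  have e₁ := h (q + min ε ε') ⟨by linarith, by linarith [min_le_left ε ε']⟩
  rw [h' (q + min ε ε') ⟨by linarith, by linarith [min_le_right ε ε']⟩] at e₁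
  have e₂ := congrFun e₁ k
  by_contra hne
  simp [eVec_apply, hne] at e₂
  exact hm.ne' e₂

lemma SlopeR.hasDerivWithinAt {f : ℝ → RVec 3} {q : ℝ} {k : Fin 3} (h : SlopeR f q k) (i : Fin 3) :
    HasDerivWithinAt (fun t => f t i) (eVec 3 k i) (Ici q) q := by
  obtain ⟨ε, hε, h⟩ := h
  have h₁ : HasDerivWithinAt (fun t => f q i + (t - q) * eVec 3 k i) (eVec 3 k i) (Ici q) q := by
    simpa using ((((hasDerivAt_id q).sub_const q).mul_const (eVec 3 k i)).const_add
      (f q i)).hasDerivWithinAt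
  refine h₁.congr_of_eventuallyEq ?_ (by simp)
  filter_upwards [Icc_mem_nhdsGE (show q < q + ε by linarith)] with t ht
  simp [h t ht]

lemma Turn.continuousAt {f : ℝ → RVec 3} {q : ℝ} (h : Turn f q) : ContinuousAt f q := by
  obtain ⟨ℓ, k, ⟨ε, hε, hl⟩, ⟨ε', hε', hr⟩, -⟩ := h
  rw [continuousAt_iff_continuous_left_right]
  have aux : ∀ (j : Fin 3) (s : Set ℝ),
      ContinuousWithinAt (fun t => f q + (t - q) • eVec 3 j) s q := fun j s => by
    apply Continuous.continuousWithinAt; fun_prop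
  constructor
  · refine (aux ℓ _).congr_of_eventuallyEq ?_ (by simp)
    filter_upwards [Icc_mem_nhdsLE (show q - ε < q by linarith)] with t ht using hl t ht
  · refine (aux k _).congr_of_eventuallyEq ?_ (by simp)
    filter_upwards [Icc_mem_nhdsGE (show q < q + ε' by linarith)] with t ht using hr t ht

namespace IsTail

variable {f : ℝ → RVec 3} {T : ℝ}

lemma exists_slopeR (hf : IsTail f T) {q : ℝ} (hq : T ≤ q) : ∃ k, SlopeR f q k := by
  obtain ⟨_, k, _, h, _⟩ := hf.turn q hq
  exact ⟨k, h⟩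

lemma continuousOn (hf : IsTail f T) : ContinuousOn f (Ici T) := fun q hq =>
  (hf.turn q hq).continuousAt.continuousWithinAt

lemma continuousOn_apply (hf : IsTail f T) {s t : ℝ} (hs : T ≤ s) (i : Fin 3) :
    ContinuousOn (fun q => f q i) (Icc s t) :=
  ((continuous_apply i).comp_continuousOn hf.continuousOn).mono
    fun _ hx => hs.trans hx.1

lemma mono (hf : IsTail f T) {s t : ℝ} (hs : T ≤ s) (hst : s ≤ t) (i : Fin 3) : f s i ≤ f t i := by
  choose! k hk using fun q (hq : T ≤ q) => hf.exists_slopeR hq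
  exact image_le_of_deriv_right_le_deriv_boundary (f := fun _ => f s i) (f' := fun _ => 0)
    continuousOn_const (fun x _ => hasDerivWithinAt_const _ _ _) le_rfl
    (hf.continuousOn_apply hs i) (fun x hx => (hk x (hs.trans hx.1)).hasDerivWithinAt i)
    (fun x _ => eVec_nonneg _ _) ⟨hst, le_rfl⟩

lemma apply_eq_of_slopes (hf : IsTail f T) {s t : ℝ} (hs : T ≤ s) {i : Fin 3}
    (h : ∀ x ∈ Ico s t, ∀ k, SlopeR f x k → k ≠ i) {x : ℝ} (hx : x ∈ Icc s t) :
    f x i = f s i := by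
  refine constant_of_has_deriv_right_zero (hf.continuousOn_apply hs i) (fun y hy => ?_) x hx
  obtain ⟨k, hk⟩ := hf.exists_slopeR (hs.trans hy.1)
  simpa [eVec_apply, (h y hy k hk).symm] using hk.hasDerivWithinAt i

lemma eq_line_of_slopes (hf : IsTail f T) {s t : ℝ} (hs : T ≤ s) {k : Fin 3}
    (h : ∀ x ∈ Ico s t, ∀ k', SlopeR f x k' → k' = k) {x : ℝ} (hx : x ∈ Icc s t) :
    f x = f s + (x - s) • eVec 3 k := by
  have hc : ∀ i, i ≠ k → f x i = f s i := fun i hi =>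
    hf.apply_eq_of_slopes hs (fun y hy k' hk' e => hi (e.symm.trans (h y hy k' hk'))) hx
  have h₁ := (hf.position s hs).2.2
  have h₂ := (hf.position x (hs.trans hx.1)).2.2
  have h₃ : f x k = f s k + (x - s) := by
    rw [← Finset.add_sum_erase _ _ (Finset.mem_univ k)] at h₁ h₂
    rw [Finset.sum_congr rfl fun i hi => hc i (Finset.ne_of_mem_erase hi)] at h₂
    linarith
  ext i
  by_cases hi : i = k
  · subst hi; simp [h₃, eVec_apply]
  · simp [hc i hi, eVec_apply, hi]

/-- As long as the components with index in `S` stay below the others, a slope in `S` can only be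
followed by slopes in `S`. -/
lemma slope_mem_of_lt (hf : IsTail f T) {s t : ℝ} (hs : T ≤ s) (hst : s ≤ t) {S : Set (Fin 3)}
    (h : ∀ x ∈ Ioc s t, ∀ ℓ ∈ S, ∀ k ∉ S, f x ℓ < f x k) {k : Fin 3} (hk : SlopeR f s k)
    (hkS : k ∈ S) {k' : Fin 3} (hk' : SlopeR f t k') : k' ∈ S := by
  by_contra hkS'
  set E : Set ℝ := {x | x ∈ Icc s t ∧ ∃ k, SlopeR f x k ∧ k ∉ S} with hE
  have hbdd : BddBelow E := ⟨s, fun x hx => hx.1.1⟩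
  have hne : E.Nonempty := ⟨t, ⟨hst, le_rfl⟩, k', hk', hkS'⟩
  have hsy : s ≤ sInf E := le_csInf hne fun x hx => hx.1.1
  have hyt : sInf E ≤ t := csInf_le hbdd ⟨⟨hst, le_rfl⟩, k', hk', hkS'⟩
  obtain ⟨ℓ, m, hℓ, hm, hle⟩ := hf.turn _ (hs.trans hsy)
  have hmS : m ∉ S := by
    intro hmS
    obtain ⟨ε, hε, hsh⟩ := hm.shift
    obtain ⟨x, hx, hxlt⟩ := exists_lt_of_csInf_lt hne (show sInf E < sInf E + ε by linarith)
    obtain ⟨j, hj, hjS⟩ := hx.2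
    exact hjS ((hsh x ⟨csInf_le hbdd hx, hxlt⟩).unique hj ▸ hmS)
  rcases hsy.eq_or_lt with he | hlt
  · rw [← he] at hm
    exact hmS (hk.unique hm ▸ hkS)
  · obtain ⟨ε, hε, hsh⟩ := hℓ.shift
    have hlt' : max s (sInf E - ε) < sInf E := max_lt hlt (by linarith)
    have hsl := hsh _ ⟨le_max_right s _, hlt'⟩
    have hℓS : ℓ ∈ S := by
      by_contra hc
      exact notMem_of_lt_csInf hlt' hbdd ⟨⟨le_max_left _ _, hlt'.le.trans hyt⟩, ℓ, hsl, hc⟩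
    exact absurd hle (not_le.2 (h _ ⟨hlt, hyt⟩ ℓ hℓS m hmS))

lemma exists_lt (hf : IsTail f T) (M : ℝ) : ∃ t₀, ∀ t, t₀ ≤ t → M < f t 0 := by
  obtain ⟨q, hq, hM⟩ := hf.unbounded M
  exact ⟨q, fun t ht => hM.trans_le (hf.mono hq ht 0)⟩

/-- The components with index in `S` catch up with the others at arbitrarily large times. -/
lemma exists_meeting (hf : IsTail f T) {S : Set (Fin 3)} (h₀ : 0 ∈ S) {j : Fin 3} (hj : j ∉ S)
    {s : ℝ} (hs : T ≤ s) : ∃ t, s ≤ t ∧ ∃ ℓ ∈ S, ∃ k ∉ S, f t k ≤ f t ℓ := by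
  by_contra! hcon
  by_cases hex : ∃ x, s ≤ x ∧ ∃ k ∈ S, SlopeR f x k
  · obtain ⟨x, hx, k, hkS, hk⟩ := hex
    obtain ⟨t₀, ht₀⟩ := hf.exists_lt (f x j)
    have h₁ := ht₀ _ (le_max_right x t₀)
    have h₂ := hf.apply_eq_of_slopes (hs.trans hx) (t := max x t₀) (i := j)
      (fun y hy m hm e => hj (e ▸ hf.slope_mem_of_lt (hs.trans hx) hy.1
        (fun z hz => hcon z (hx.trans hz.1.le)) hk hkS hm)) ⟨le_max_left _ _, le_rfl⟩
    have h₃ := (hf.position (max x t₀) (hs.trans (hx.trans (le_max_left _ _)))).zero_le j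
    linarith
  · push Not at hex
    obtain ⟨t₀, ht₀⟩ := hf.exists_lt (f s 0)
    have h₁ := ht₀ _ (le_max_right s t₀)
    have h₂ := hf.apply_eq_of_slopes hs (t := max s t₀) (i := 0)
      (fun y hy m hm e => hex y hy.1 0 h₀ (e ▸ hm)) ⟨le_max_left _ _, le_rfl⟩
    linarith

lemma exists_meeting₀₁ (hf : IsTail f T) {s : ℝ} (hs : T ≤ s) : ∃ t, s ≤ t ∧ f t 0 = f t 1 := by
  obtain ⟨t, ht, ℓ, hℓ, k, hk, hle⟩ := hf.exists_meeting (S := {0}) rfl (j := 1) (by simp) hs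
  have hp := hf.position t (hs.trans ht)
  rw [mem_singleton_iff] at hℓ hk
  subst hℓ
  have : f t 1 ≤ f t k := hp.2.1 (by omega)
  exact ⟨t, ht, le_antisymm hp.le₀₁ (this.trans hle)⟩

lemma exists_meeting₁₂ (hf : IsTail f T) {s : ℝ} (hs : T ≤ s) : ∃ t, s ≤ t ∧ f t 1 = f t 2 := by
  obtain ⟨t, ht, ℓ, hℓ, k, hk, hle⟩ :=
    hf.exists_meeting (S := {ℓ | ℓ ≤ 1}) (by simp) (j := 2) (by decide) hs
  have hp := hf.position t (hs.trans ht)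
  simp only [mem_ofPred_eq, not_le] at hℓ hk
  have h₁ : f t ℓ ≤ f t 1 := hp.2.1 hℓ
  have h₂ : f t 2 ≤ f t k := hp.2.1 (by omega)
  exact ⟨t, ht, le_antisymm hp.le₁₂ (h₂.trans (hle.trans h₁))⟩

/-- First meeting time of two components after a given time. -/
lemma exists_first_eq (hf : IsTail f T) {s t : ℝ} (hs : T ≤ s) (hst : s ≤ t) {i j : Fin 3}
    (h : f t i = f t j) : ∃ u ∈ Icc s t, f u i = f u j ∧ ∀ x ∈ Ico s u, f x i ≠ f x j := by
  have hcl : IsClosed {x | x ∈ Icc s t ∧ f x i = f x j} :=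
    isClosed_Icc.isClosed_eq (hf.continuousOn_apply hs i) (hf.continuousOn_apply hs j)
  have hbdd : BddBelow {x | x ∈ Icc s t ∧ f x i = f x j} := ⟨s, fun x hx => hx.1.1⟩
  have hmem := hcl.csInf_mem ⟨t, ⟨hst, le_rfl⟩, h⟩ hbdd
  exact ⟨_, hmem.1, hmem.2, fun x hx he =>
    notMem_of_lt_csInf hx.2 hbdd ⟨⟨hx.1, hx.2.le.trans hmem.1.2⟩, he⟩⟩

/-- Last meeting time of two components before a given time. -/
lemma exists_last_eq (hf : IsTail f T) {s t : ℝ} (hs : T ≤ s) (hst : s ≤ t) {i j : Fin 3}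
    (h : f s i = f s j) : ∃ u ∈ Icc s t, f u i = f u j ∧ ∀ x ∈ Ioc u t, f x i ≠ f x j := by
  have hcl : IsClosed {x | x ∈ Icc s t ∧ f x i = f x j} :=
    isClosed_Icc.isClosed_eq (hf.continuousOn_apply hs i) (hf.continuousOn_apply hs j)
  have hbdd : BddAbove {x | x ∈ Icc s t ∧ f x i = f x j} := ⟨t, fun x hx => hx.1.2⟩
  have hmem := hcl.csSup_mem ⟨s, ⟨le_rfl, hst⟩, h⟩ hbdd
  exact ⟨_, hmem.1, hmem.2, fun x hx he =>
    notMem_of_csSup_lt hx.1 hbdd ⟨⟨hmem.1.1.trans hx.1.le, hx.2⟩, he⟩⟩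

end IsTail

/-- Between the times `A` and `B` the middle component of `f` rises from the first component to the
third one; later, between `D` and `C`, the first component rises up to the middle one, the first
component being constant on `[A, D]`. -/
structure PairCycle (f : ℝ → RVec 3) (A B D C : ℝ) : Prop where
  hAB : A ≤ B
  hBD : B ≤ D
  hDC : D ≤ C
  eq_A : f A 0 = f A 1
  eq_B : f B 1 = f B 2
  line_AB : ∀ x ∈ Icc A B, f x = f A + (x - A) • eVec 3 1
  const : f D 0 = f B 0
  le_D : f B 1 ≤ f D 1
  line_DC : ∀ x ∈ Icc D C, f x = f D + (x - D) • eVec 3 0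
  eq_C : f C 0 = f C 1
  slope_A : ∃ k, SlopeR f A k ∧ f A k ≤ f A 0
  slope_B : ∃ ℓ, SlopeL f B ℓ ∧ f B 2 ≤ f B ℓ

namespace IsTail

variable {f : ℝ → RVec 3} {T : ℝ}

lemma exists_first_half (hf : IsTail f T) {s : ℝ} (hs : T ≤ s) :
    ∃ A B, s ≤ A ∧ A ≤ B ∧ f A 0 = f A 1 ∧ f B 1 = f B 2 ∧
      ∀ x ∈ Ico A B, ∀ k, SlopeR f x k → k = 1 := by
  obtain ⟨s', hs', hA'⟩ := hf.exists_meeting₀₁ hs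
  have hTs' := hs.trans hs'
  obtain ⟨B', hB', hB''⟩ := hf.exists_meeting₁₂ hTs'
  obtain ⟨B, hB, hfB, hB₁⟩ := hf.exists_first_eq hTs' hB' hB''
  obtain ⟨A, hA, hfA, hA₁⟩ := hf.exists_last_eq hTs' hB.1 hA'
  have hTA : T ≤ A := hTs'.trans hA.1
  refine ⟨A, B, hs'.trans hA.1, hA.2, hfA, hfB, fun x hx k hk => ?_⟩
  have hk₂ : k ≠ 2 := by
    rintro rfl
    obtain ⟨ε, hε, hsh⟩ := hk.shift
    have hAz : A < min (x + ε) B := lt_min (by linarith [hx.1]) (hx.1.trans_lt hx.2)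
    have hsl : ∀ y ∈ Ico A (min (x + ε) B), ∀ m, SlopeR f y m → m = 2 := by
      intro y hy m hm
      rcases le_or_gt x y with hxy | hxy
      · exact hm.unique (hsh y ⟨hxy, hy.2.trans_le (min_le_left _ _)⟩)
      · by_contra hm₂
        refine absurd (hf.slope_mem_of_lt (S := {ℓ | ℓ ≤ 1}) (hTA.trans hy.1) hxy.le ?_ hm
          (show m ≤ 1 by omega) hk) (show ¬ (2 : Fin 3) ≤ 1 by decide)
        intro z hz ℓ hℓ j hj
        have hp := hf.position z (hTA.trans (hy.1.trans hz.1.le))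
        have hne := hB₁ z ⟨hA.1.trans (hy.1.trans hz.1.le), hz.2.trans_lt hx.2⟩
        simp only [mem_ofPred_eq, not_le] at hℓ hj
        obtain rfl : j = 2 := by omega
        exact (hp.2.1 hℓ).trans_lt (lt_of_le_of_ne hp.le₁₂ hne)
    have hl := hf.eq_line_of_slopes hTA hsl ⟨hAz.le, le_rfl⟩
    refine hA₁ _ ⟨hAz, min_le_right _ _⟩ ?_
    rw [hl]
    simp [eVec, hfA]
  have hk₀ : k ≠ 0 := by
    rintro rfl
    have hTx := hTA.trans hx.1
    have hsl : ∀ y ∈ Ico x B, ∀ m, SlopeR f y m → m = 0 := by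
      intro y hy m hm
      refine hf.slope_mem_of_lt (S := {0}) hTx hy.1 ?_ hk rfl hm
      intro z hz ℓ hℓ j hj
      have hp := hf.position z (hTx.trans hz.1.le)
      have hne := hA₁ z ⟨hx.1.trans_lt hz.1, hz.2.trans hy.2.le⟩
      rw [mem_singleton_iff] at hℓ hj
      subst hℓ
      exact (lt_of_le_of_ne hp.le₀₁ hne).trans_le (hp.2.1 (by omega))
    have hl := hf.eq_line_of_slopes hTx hsl ⟨hx.2.le, le_rfl⟩
    refine hB₁ x ⟨hA.1.trans hx.1, hx.2⟩ ?_
    rw [hl] at hfB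
    simpa [eVec] using hfB
  omega

lemma exists_second_half (hf : IsTail f T) {B : ℝ} (hB : T ≤ B) :
    ∃ D C, B ≤ D ∧ D ≤ C ∧ f D 0 = f B 0 ∧ f C 0 = f C 1 ∧
      ∀ x ∈ Ico D C, ∀ k, SlopeR f x k → k = 0 := by
  obtain ⟨C', hC', hfC'⟩ := hf.exists_meeting₀₁ hB
  obtain ⟨C, hC, hfC, hC₁⟩ := hf.exists_first_eq hB hC' hfC'
  have hcl : IsClosed {x | x ∈ Icc B C ∧ f x 0 = f B 0} :=
    isClosed_Icc.isClosed_eq (hf.continuousOn_apply hB 0) continuousOn_const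
  have hbdd : BddAbove {x | x ∈ Icc B C ∧ f x 0 = f B 0} := ⟨C, fun x hx => hx.1.2⟩
  obtain ⟨hD, hfD⟩ := hcl.csSup_mem ⟨B, ⟨le_rfl, hC.1⟩, rfl⟩ hbdd
  set D := sSup {x | x ∈ Icc B C ∧ f x 0 = f B 0}
  have hDx : ∀ x ∈ Ioo D C, ∀ k, SlopeR f x k → k = 0 := by
    intro x hx k hk
    by_contra hk₀
    refine notMem_of_csSup_lt hx.1 hbdd ⟨⟨hD.1.trans hx.1.le, hx.2.le⟩, ?_⟩
    refine hf.apply_eq_of_slopes hB (t := x) (fun y hy m hm hm₀ => hk₀ ?_)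
      ⟨hD.1.trans hx.1.le, le_rfl⟩
    refine hf.slope_mem_of_lt (S := {0}) (hB.trans hy.1) hy.2.le ?_ hm hm₀ hk
    intro z hz ℓ hℓ j hj
    have hp := hf.position z (hB.trans (hy.1.trans hz.1.le))
    have hne := hC₁ z ⟨hy.1.trans hz.1.le, hz.2.trans_lt hx.2⟩
    rw [mem_singleton_iff] at hℓ hj
    subst hℓ
    exact (lt_of_le_of_ne hp.le₀₁ hne).trans_le (hp.2.1 (by omega))
  refine ⟨D, C, hD.1, hD.2, hfD, hfC, fun x hx k hk => ?_⟩
  obtain ⟨ε, hε, hsh⟩ := hk.shift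
  obtain ⟨y, hxy, hy⟩ := exists_between (lt_min (show x < x + ε by linarith) hx.2)
  exact hDx y ⟨hx.1.trans_lt hxy, hy.trans_le (min_le_right _ _)⟩ k
    (hsh y ⟨hxy.le, hy.trans_le (min_le_left _ _)⟩)

lemma exists_cycle (hf : IsTail f T) {s : ℝ} (hs : T ≤ s) :
    ∃ A B D C, s ≤ A ∧ PairCycle f A B D C := by
  obtain ⟨A, B, hsA, hAB, hfA, hfB, hslAB⟩ := hf.exists_first_half hs
  have hTA := hs.trans hsA
  obtain ⟨D, C, hBD, hDC, hfD, hfC, hslDC⟩ := hf.exists_second_half (hTA.trans hAB)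
  have hline := fun x hx => hf.eq_line_of_slopes (x := x) hTA hslAB hx
  refine ⟨A, B, D, C, hsA, hAB, hBD, hDC, hfA, hfB, hline, hfD, hf.mono (hTA.trans hAB) hBD 1,
    fun x hx => hf.eq_line_of_slopes (hTA.trans (hAB.trans hBD)) hslDC hx, hfC, ?_, ?_⟩
  · obtain ⟨k, hk⟩ := hf.exists_slopeR hTA
    refine ⟨k, hk, ?_⟩
    rcases hAB.eq_or_lt with he | hlt
    · have := (hf.position A hTA).le_two k
      rw [← he] at hfB
      linarith
    · rw [hslAB A ⟨le_rfl, hlt⟩ k hk, hfA]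
  · obtain ⟨ℓ, -, hℓ, -⟩ := hf.turn B (hTA.trans hAB)
    refine ⟨ℓ, hℓ, ?_⟩
    rcases hAB.eq_or_lt with he | hlt
    · have := (hf.position B (hTA.trans hAB)).zero_le ℓ
      rw [he] at hfA
      linarith
    · obtain ⟨ε, hε, hsh⟩ := hℓ.shift
      have hlt' : max A (B - ε) < B := max_lt hlt (by linarith)
      rw [hslAB _ ⟨le_max_left _ _, hlt'⟩ ℓ (hsh _ ⟨le_max_right _ _, hlt'⟩), hfB]

end IsTail

/-- One can pass from any cycle of a system to any cycle of another one along a segment. -/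
lemma PairCycle.exists_transition {f g : ℝ → RVec 3} {T T' A B D C A' B' D' C' : ℝ}
    (hf : IsTail f T) (hg : IsTail g T') (hA : T ≤ A) (hA' : T' ≤ A') (h : PairCycle f A B D C)
    (h' : PairCycle g A' B' D' C') :
    ∃ t ∈ Icc A B, ∃ s ∈ Icc A' C', ∃ L lam : ℝ, ∃ k : Fin 3, 0 ≤ L ∧ 0 < lam ∧
      f t + L • eVec 3 k = lam • g s ∧ (∃ ℓ, SlopeL f t ℓ ∧ f t k ≤ f t ℓ) ∧
      ∃ m, SlopeR g s m ∧ g s m ≤ g s k := by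
  have pA := hf.position A hA
  have pA' := hg.position A' hA'
  have hBD' := hA'.trans h'.hAB
  have pD' := hg.position D' (hBD'.trans h'.hBD)
  have a0 := hf.pos A hA
  have a0' := hg.pos A' hA'
  have hB := h.line_AB B ⟨h.hAB, le_rfl⟩
  have hB' := h'.line_AB B' ⟨h'.hAB, le_rfl⟩
  have hC' := h'.line_DC C' ⟨h'.hDC, le_rfl⟩
  have eB := h.eq_B
  have eB' := h'.eq_B
  have eC' := h'.eq_C
  have cD' := h'.const
  have lD' := h'.le_D
  rw [hB] at eB
  rw [hB'] at eB' cD' lD'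
  rw [hC'] at eC'
  simp [eVec] at eB eB' eC' cD' lD'
  have eA := h.eq_A
  have eA' := h'.eq_A
  have q₁ := pA.le₁₂
  have q₁' := pA'.le₁₂
  have c0 : 0 < f A 2 := by linarith
  have c0' : 0 < g A' 2 := by linarith
  rcases lt_or_ge (g A' 2 * f A 0) (f A 2 * g A' 0) with hlt | hle
  · set m := f A 2 * g A' 0 / g A' 2 with hm
    have m₁ : f A 0 < m := by rw [hm, lt_div_iff₀ c0']; linarith
    have m₂ : m ≤ f A 2 := by
      rw [hm, div_le_iff₀ c0']; exact mul_le_mul_of_nonneg_left (by linarith) c0.le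
    have ht : A + (m - f A 0) ∈ Icc A B := ⟨by linarith, by linarith⟩
    obtain ⟨ℓ, -, hℓ, -⟩ := hf.turn _ (hA.trans ht.1)
    refine ⟨_, ht, A', ⟨le_rfl, h'.hAB.trans (h'.hBD.trans h'.hDC)⟩, m - f A 0, f A 2 / g A' 2, 0,
      by linarith, by positivity, ?_, ⟨ℓ, hℓ, (hf.position _ (hA.trans ht.1)).zero_le ℓ⟩, h'.slope_A⟩
    rw [h.line_AB _ ht]
    ext i
    fin_cases i <;> simp [eVec]
    · rw [hm]; ring
    · rw [← eA, ← eA', hm]; ring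
    · field_simp
  · have d0 : 0 < g D' 1 := by linarith
    set δ := f A 0 * g D' 1 / f A 2 with hδ
    have δ₁ : g A' 0 ≤ δ := by
      rw [hδ, le_div_iff₀ c0]
      have := mul_le_mul_of_nonneg_left (show g A' 2 ≤ g D' 1 by linarith) a0.le
      linarith
    have δ₂ : δ ≤ g D' 1 := by
      rw [hδ, div_le_iff₀ c0, mul_comm]; exact mul_le_mul_of_nonneg_left (by linarith) d0.le
    have hs : D' + (δ - g A' 0) ∈ Icc D' C' := ⟨by linarith, by linarith⟩
    have hs' : D' + (δ - g A' 0) ∈ Icc A' C' := ⟨h'.hAB.trans (h'.hBD.trans hs.1), hs.2⟩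
    obtain ⟨m, hm⟩ := hg.exists_slopeR (hA'.trans hs'.1)
    refine ⟨B, ⟨h.hAB, le_rfl⟩, _, hs', f A 2 * g D' 2 / g D' 1 - f A 2, f A 2 / g D' 1, 2,
      ?_, by positivity, ?_, h.slope_B, m, hm, (hg.position _ (hA'.trans hs'.1)).le_two m⟩
    · rw [sub_nonneg, le_div_iff₀ d0]; exact mul_le_mul_of_nonneg_left pD'.le₁₂ c0.le
    · rw [h'.line_DC _ hs, hB]
      ext i
      fin_cases i <;> simp [eVec]
      · rw [cD', hδ]; field_simp; ring
      · rw [eB]; field_simp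
      · field_simp

/-- `x` is a limit of points `q⁻¹ • f q` with `q` tending to infinity. -/
def IsLimitPoint (f : ℝ → RVec 3) (x : RVec 3) : Prop :=
  ∃ q : ℕ → ℝ, Tendsto q atTop atTop ∧ Tendsto (fun i => (q i)⁻¹ • f (q i)) atTop (𝓝 x)

lemma mem_FSet_iff {f : ℝ → RVec 3} {T : ℝ} {I : Set ℝ} (hI : Ioi T ⊆ I) {x : RVec 3} :
    x ∈ FSet 3 I f ↔ IsLimitPoint f x := by
  constructor
  · rintro ⟨q, -, -, hq, hx⟩
    exact ⟨q, hq, hx⟩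
  · rintro ⟨q, hq, hx⟩
    obtain ⟨φ, hφ, hqφ⟩ := strictMono_subseq_of_tendsto_atTop hq
    have hq' := hq.comp hφ.tendsto_atTop
    obtain ⟨N, hN⟩ := eventually_atTop.1 (hq'.eventually_gt_atTop T)
    exact ⟨fun i => q (φ (i + N)), fun i => hI (hN _ (Nat.le_add_left _ _)),
      fun i j hij => hqφ (by omega), hq'.comp (tendsto_add_atTop_nat N),
      (hx.comp hφ.tendsto_atTop).comp (tendsto_add_atTop_nat N)⟩

lemma IsLimitPoint.exists_seq {f : ℝ → RVec 3} {x : RVec 3} (hx : IsLimitPoint f x)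
    {E : ℕ → ℝ → Prop} (hE : ∀ n, ∀ᶠ q in atTop, E n q) :
    ∃ q : ℕ → ℝ, (∀ n, E n (q n)) ∧ Tendsto (fun i => (q i)⁻¹ • f (q i)) atTop (𝓝 x) := by
  obtain ⟨q, hq, hx⟩ := hx
  have h : ∀ n : ℕ, ∃ i, E n (q i) ∧ dist ((q i)⁻¹ • f (q i)) x < 1 / (n + 1 : ℝ) := fun n =>
    ((hq.eventually (hE n)).and
      (hx.eventually (Metric.ball_mem_nhds x (by positivity)))).exists
  choose i hi hd using h
  refine ⟨q ∘ i, hi, ?_⟩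
  rw [tendsto_iff_dist_tendsto_zero]
  exact squeeze_zero (fun _ => dist_nonneg) (fun n => (hd n).le)
    tendsto_one_div_add_atTop_nhds_zero_nat

lemma IsTail.normalized_mem {f : ℝ → RVec 3} {T q : ℝ} (hf : IsTail f T) (hq : T ≤ q) :
    q⁻¹ • f q ∈ Icc (0 : RVec 3) 1 := by
  obtain ⟨h₀, -, h⟩ := hf.position q hq
  have hle : ∀ i, f q i ≤ q := fun i =>
    (Finset.single_le_sum (fun j _ => h₀ j) (Finset.mem_univ i)).trans_eq h
  have hq₀ : 0 < q := (hf.pos q hq).trans_le (hle 0)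
  exact ⟨fun i => mul_nonneg (by positivity) (h₀ i), fun i => by
    simpa using inv_mul_le_one_of_le₀ (hle i) hq₀.le⟩

/-- If the directions of `P` are, asymptotically, those of `f`, those of `g`, and points on segments
joining directions of `f` and `g`, then `P` has the expected convex hull of limit points. -/
lemma convexHull_limitPoints {f g P : ℝ → RVec 3} {T T' : ℝ} (hf : IsTail f T) (hg : IsTail g T')
    (h : ∀ N : ℝ, ∀ᶠ q in atTop, ∃ τ ≥ N, ∃ τ' ≥ N, ∃ θ ∈ Icc (0 : ℝ) 1,
      q⁻¹ • P q = (1 - θ) • τ⁻¹ • f τ + θ • τ'⁻¹ • g τ')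
    (h₁ : ∀ N : ℝ, ∀ᶠ q in atTop, ∃ q' ≥ N, q'⁻¹ • P q' = q⁻¹ • f q)
    (h₂ : ∀ N : ℝ, ∀ᶠ q in atTop, ∃ q' ≥ N, q'⁻¹ • P q' = q⁻¹ • g q) :
    convexHull ℝ {x | IsLimitPoint P x} =
      convexHull ℝ (convexHull ℝ {x | IsLimitPoint f x} ∪ convexHull ℝ {x | IsLimitPoint g x}) := by
  have aux : ∀ {k : ℝ → RVec 3}, (∀ N : ℝ, ∀ᶠ q in atTop, ∃ q' ≥ N, q'⁻¹ • P q' = q⁻¹ • k q) →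
      {x | IsLimitPoint k x} ⊆ {x | IsLimitPoint P x} := by
    intro k hk x hx
    obtain ⟨q, hq, hlim⟩ := IsLimitPoint.exists_seq hx fun n : ℕ => hk n
    choose q' hq' he using hq
    exact ⟨q', tendsto_atTop_mono hq' tendsto_natCast_atTop_atTop, by simpa only [he] using hlim⟩
  apply Subset.antisymm
  · refine convexHull_min ?_ (convex_convexHull ℝ _)
    intro x hx
    obtain ⟨q, hq, hlim⟩ := IsLimitPoint.exists_seq hx fun n : ℕ => h (max n (max T T'))
    choose τ hτ τ' hτ' θ hθ he using hq
    have hcpt : IsCompact (Icc (0 : RVec 3) 1 ×ˢ Icc (0 : RVec 3) 1 ×ˢ Icc (0 : ℝ) 1) :=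
      isCompact_Icc.prod (isCompact_Icc.prod isCompact_Icc)
    obtain ⟨⟨u, v, w⟩, ⟨-, -, hw⟩, φ, hφ, hconv⟩ := hcpt.tendsto_subseq
      (x := fun n => ((τ n)⁻¹ • f (τ n), (τ' n)⁻¹ • g (τ' n), θ n)) fun n =>
        ⟨hf.normalized_mem (((le_max_left _ _).trans (le_max_right _ _)).trans (hτ n)),
          hg.normalized_mem (((le_max_right _ _).trans (le_max_right _ _)).trans (hτ' n)), hθ n⟩
    have c₁ := (continuous_fst.tendsto _).comp hconv
    have c₂ := ((continuous_fst.comp continuous_snd).tendsto _).comp hconv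
    have c₃ := ((continuous_snd.comp continuous_snd).tendsto _).comp hconv
    have hu : u ∈ {x | IsLimitPoint f x} := ⟨τ ∘ φ, (tendsto_atTop_mono
      (fun n => (le_max_left _ _).trans (hτ n)) tendsto_natCast_atTop_atTop).comp
        hφ.tendsto_atTop, c₁⟩
    have hv : v ∈ {x | IsLimitPoint g x} := ⟨τ' ∘ φ, (tendsto_atTop_mono
      (fun n => (le_max_left _ _).trans (hτ' n)) tendsto_natCast_atTop_atTop).comp
        hφ.tendsto_atTop, c₂⟩
    have hx' : x = (1 - w) • u + w • v := by
      refine tendsto_nhds_unique (hlim.comp hφ.tendsto_atTop) ?_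
      refine Tendsto.congr (fun n => (he (φ n)).symm) ?_
      exact ((tendsto_const_nhds.sub c₃).smul c₁).add (c₃.smul c₂)
    rw [hx']
    have hu' := subset_convexHull ℝ _ hu
    have hv' := subset_convexHull ℝ _ hv
    exact convex_convexHull ℝ _ (subset_convexHull ℝ _ (mem_union_left _ hu'))
      (subset_convexHull ℝ _ (mem_union_right _ hv')) (sub_nonneg.2 hw.2) hw.1 (by ring)
  · exact convexHull_min (union_subset (convexHull_mono (aux h₁)) (convexHull_mono (aux h₂)))
      (convex_convexHull ℝ _)

lemma SlopeL.congr {f g : ℝ → RVec 3} {p q : ℝ} {ℓ : Fin 3} (h : SlopeL f q ℓ) (hpq : p < q)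
    (he : ∀ t ∈ Icc p q, g t = f t) : SlopeL g q ℓ := by
  obtain ⟨ε, hε, h⟩ := h
  refine ⟨min ε (q - p), lt_min hε (by linarith), fun t ht => ?_⟩
  have h₁ := min_le_left ε (q - p)
  have h₂ := min_le_right ε (q - p)
  rw [he t ⟨by linarith [ht.1], ht.2⟩, he q ⟨hpq.le, le_rfl⟩, h t ⟨by linarith [ht.1], ht.2⟩]

lemma SlopeR.congr {f g : ℝ → RVec 3} {p q : ℝ} {k : Fin 3} (h : SlopeR f q k) (hpq : q < p)
    (he : ∀ t ∈ Icc q p, g t = f t) : SlopeR g q k := by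
  obtain ⟨ε, hε, h⟩ := h
  refine ⟨min ε (p - q), lt_min hε (by linarith), fun t ht => ?_⟩
  have h₁ := min_le_left ε (p - q)
  have h₂ := min_le_right ε (p - q)
  rw [he t ⟨ht.1, by linarith [ht.2]⟩, he q ⟨le_rfl, hpq.le⟩, h t ⟨ht.1, by linarith [ht.2]⟩]

lemma Turn.congr {f g : ℝ → RVec 3} {p p' q : ℝ} (h : Turn f q) (hq : q ∈ Ioo p p')
    (he : ∀ t ∈ Icc p p', g t = f t) : Turn g q := by
  obtain ⟨ℓ, k, hℓ, hk, hle⟩ := h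
  refine ⟨ℓ, k, hℓ.congr hq.1 fun t ht => he t ⟨ht.1, ht.2.trans hq.2.le⟩,
    hk.congr hq.2 fun t ht => he t ⟨hq.1.le.trans ht.1, ht.2⟩, ?_⟩
  rwa [he q ⟨hq.1.le, hq.2.le⟩]

/-- The map `f` up to time `t`, followed by a line of slope `e_k`. -/
def follow (f : ℝ → RVec 3) (t : ℝ) (k : Fin 3) (q : ℝ) : RVec 3 :=
  if q ≤ t then f q else f t + (q - t) • eVec 3 k

lemma follow_of_le {f : ℝ → RVec 3} {t : ℝ} {k : Fin 3} {q : ℝ} (h : q ≤ t) :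
    follow f t k q = f q := if_pos h

lemma follow_of_ge {f : ℝ → RVec 3} {t : ℝ} {k : Fin 3} {q : ℝ} (h : t ≤ q) :
    follow f t k q = f t + (q - t) • eVec 3 k := by
  rcases h.eq_or_lt with rfl | h
  · simp [follow]
  · exact if_neg (not_le.2 h)

lemma slopeR_follow {f : ℝ → RVec 3} {t : ℝ} {k : Fin 3} {q : ℝ} (h : t ≤ q) :
    SlopeR (follow f t k) q k := by
  refine ⟨1, one_pos, fun x hx => ?_⟩
  rw [follow_of_ge h, follow_of_ge (h.trans hx.1), add_assoc, ← add_smul]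
  congr 2; ring

lemma slopeL_follow {f : ℝ → RVec 3} {t : ℝ} {k : Fin 3} {q : ℝ} (h : t < q) :
    SlopeL (follow f t k) q k := by
  refine ⟨q - t, by linarith, fun x hx => ?_⟩
  rw [follow_of_ge h.le, follow_of_ge (by linarith [hx.1]), add_assoc, ← add_smul]
  congr 2; ring

lemma exists_slopeL_follow {f : ℝ → RVec 3} {t : ℝ} {k : Fin 3} {q : ℝ} (h : t ≤ q)
    (ht : ∃ ℓ, SlopeL f t ℓ ∧ f t k ≤ f t ℓ) :
    ∃ ℓ, SlopeL (follow f t k) q ℓ ∧ follow f t k q k ≤ follow f t k q ℓ := by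
  rcases h.eq_or_lt with rfl | h
  · obtain ⟨ℓ, hℓ, hle⟩ := ht
    refine ⟨ℓ, hℓ.congr (show t - 1 < t by linarith) fun x hx => follow_of_le hx.2, ?_⟩
    rwa [follow_of_le le_rfl]
  · exact ⟨k, slopeL_follow h, le_rfl⟩

lemma turn_follow {f : ℝ → RVec 3} {t : ℝ} {k : Fin 3} {q : ℝ} (hq : q < t → Turn f q)
    (ht : ∃ ℓ, SlopeL f t ℓ ∧ f t k ≤ f t ℓ) : Turn (follow f t k) q := by
  rcases lt_or_ge q t with h | h
  · exact (hq h).congr (p := q - 1) ⟨by linarith, h⟩ fun x hx => follow_of_le hx.2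
  · obtain ⟨ℓ, hℓ, hle⟩ := exists_slopeL_follow h ht
    exact ⟨ℓ, k, hℓ, slopeR_follow h, hle⟩

/-- The image of `f` under the homothety of ratio `μ`. -/
def dilate (μ : ℝ) (f : ℝ → RVec 3) (q : ℝ) : RVec 3 := μ • f (μ⁻¹ * q)

lemma dilate_mul {μ : ℝ} (hμ : 0 < μ) (f : ℝ → RVec 3) (q : ℝ) :
    dilate μ f (μ * q) = μ • f q := by
  rw [dilate, inv_mul_cancel_left₀ hμ.ne']

lemma exists_mul_of_mem_Icc {μ a b q : ℝ} (hμ : 0 < μ) (hq : q ∈ Icc (μ * a) (μ * b)) :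
    ∃ y ∈ Icc a b, q = μ * y :=
  ⟨μ⁻¹ * q, ⟨by rw [le_inv_mul_iff₀ hμ]; exact hq.1, by rw [inv_mul_le_iff₀ hμ]; exact hq.2⟩,
    (mul_inv_cancel_left₀ hμ.ne' q).symm⟩

lemma SlopeL.dilate {f : ℝ → RVec 3} {μ q : ℝ} {ℓ : Fin 3} (hμ : 0 < μ) (h : SlopeL f q ℓ) :
    SlopeL (dilate μ f) (μ * q) ℓ := by
  obtain ⟨ε, hε, h⟩ := h
  refine ⟨μ * ε, by positivity, fun t ht => ?_⟩
  rw [← mul_sub] at ht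
  obtain ⟨y, hy, rfl⟩ := exists_mul_of_mem_Icc hμ ht
  rw [dilate_mul hμ, dilate_mul hμ, h y hy, smul_add, smul_smul, mul_sub]

lemma SlopeR.dilate {f : ℝ → RVec 3} {μ q : ℝ} {k : Fin 3} (hμ : 0 < μ) (h : SlopeR f q k) :
    SlopeR (dilate μ f) (μ * q) k := by
  obtain ⟨ε, hε, h⟩ := h
  refine ⟨μ * ε, by positivity, fun t ht => ?_⟩
  rw [← mul_add] at ht
  obtain ⟨y, hy, rfl⟩ := exists_mul_of_mem_Icc hμ ht
  rw [dilate_mul hμ, dilate_mul hμ, h y hy, smul_add, smul_smul, mul_sub]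

lemma Turn.dilate {f : ℝ → RVec 3} {μ q : ℝ} (hμ : 0 < μ) (h : Turn f q) :
    Turn (dilate μ f) (μ * q) := by
  obtain ⟨ℓ, k, hℓ, hk, hle⟩ := h
  refine ⟨ℓ, k, hℓ.dilate hμ, hk.dilate hμ, ?_⟩
  rw [dilate_mul hμ]
  exact mul_le_mul_of_nonneg_left hle hμ.le

lemma IsPosition.smul {v : RVec 3} {q μ : ℝ} (hμ : 0 < μ) (h : IsPosition v q) :
    IsPosition (μ • v) (μ * q) :=
  ⟨fun i => mul_nonneg hμ.le (h.1 i), fun _ _ hij => mul_le_mul_of_nonneg_left (h.2.1 hij) hμ.le,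
    by simp [← Finset.mul_sum, h.2.2]⟩

lemma IsPosition.segment {v : RVec 3} {q L w : ℝ} {k : Fin 3} (h : IsPosition v q)
    (h' : Monotone (v + L • eVec 3 k)) (hw : w ∈ Icc 0 L) :
    IsPosition (v + w • eVec 3 k) (q + w) := by
  refine ⟨fun i => add_nonneg (h.1 i) (mul_nonneg hw.1 (eVec_nonneg _ _)), fun i j hij => ?_, ?_⟩
  · have h₁ := h.2.1 hij
    have h₂ := h' hij
    simp only [Pi.add_apply, Pi.smul_apply, smul_eq_mul] at h₂ ⊢
    rcases le_total (eVec 3 k i) (eVec 3 k j) with hd | hd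
    · nlinarith [mul_le_mul_of_nonneg_left hd hw.1]
    · nlinarith [mul_nonneg (sub_nonneg.2 hw.2) (sub_nonneg.2 hd)]
  · simp [Finset.sum_add_distrib, ← Finset.mul_sum, sum_eVec, h.2.2]

/-- Maps which agree at the end points of consecutive intervals can be glued together. -/
lemma exists_glue {Q : ℕ → ℝ → RVec 3} {x : ℕ → ℝ} (hx : StrictMono x)
    (hx' : Tendsto x atTop atTop) (hQ : ∀ n, Q n (x (n + 1)) = Q (n + 1) (x (n + 1))) :
    ∃ P : ℝ → RVec 3, ∀ n, ∀ q ∈ Icc (x n) (x (n + 1)), P q = Q n q := by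
  classical
  have hex : ∀ q, ∃ n, q < x (n + 1) := fun q =>
    ((tendsto_add_atTop_nat 1 |> hx'.comp).eventually_gt_atTop q).exists
  have key : ∀ n, ∀ q ∈ Ico (x n) (x (n + 1)), Nat.find (hex q) = n := fun n q hq => by
    rw [Nat.find_eq_iff]
    exact ⟨hq.2, fun m hm => not_lt.2 ((hx.monotone hm).trans hq.1)⟩
  refine ⟨fun q => Q (Nat.find (hex q)) q, fun n q hq => ?_⟩
  rcases hq.2.eq_or_lt with rfl | hlt
  · simp only [key (n + 1) _ ⟨le_rfl, hx (Nat.lt_succ_self _)⟩, hQ]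
  · simp only [key n q ⟨hq.1, hlt⟩]

lemma exists_mem_Ioc_of_tendsto {x : ℕ → ℝ} (hx' : Tendsto x atTop atTop) {m : ℕ} {q : ℝ}
    (hq : x m < q) : ∃ n ≥ m, q ∈ Ioc (x n) (x (n + 1)) := by
  classical
  have hex : ∃ n, q ≤ x (m + n) :=
    (((tendsto_add_atTop_nat m).congr fun n => add_comm n m) |> hx'.comp
      |>.eventually_ge_atTop q).exists
  obtain ⟨n, hn⟩ := Nat.exists_eq_succ_of_ne_zero (n := Nat.find hex) (by
    intro h0
    have := Nat.find_spec hex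
    rw [h0] at this
    exact absurd this (not_le.2 hq))
  refine ⟨m + n, Nat.le_add_right _ _, not_le.1 (Nat.find_min hex (by omega)), ?_⟩
  have := Nat.find_spec hex
  rwa [hn] at this

lemma IsTail.of_le {f : ℝ → RVec 3} {T T' : ℝ} (h : IsTail f T) (hT : T ≤ T') : IsTail f T' where
  position q hq := h.position q (hT.trans hq)
  turn q hq := h.turn q (hT.trans hq)
  pos q hq := h.pos q (hT.trans hq)
  unbounded M := by
    obtain ⟨t₀, ht₀⟩ := h.exists_lt M
    exact ⟨max T' t₀, le_max_left _ _, ht₀ _ (le_max_right _ _)⟩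

lemma IsProperSys.exists_isTail {I : Set ℝ} {P : ℝ → RVec 3} (h : IsProperSys 3 I P) :
    ∃ T, IsTail P T ∧ Ioi T ⊆ I := by
  obtain ⟨⟨hI₀, hI, -, hP⟩, hub⟩ := h
  have hpos : ∀ q ∈ I, IsPosition (P q) q := fun q hq => (hP q hq).1
  have hbig : ∀ M, ∃ q ∈ I, M < q := fun M => by
    obtain ⟨q, hq, hM⟩ := hub M
    have := hpos q hq
    exact ⟨q, hq, (hM 0).trans_le (by linarith [this.sum_eq, this.1 1, this.1 2])⟩
  obtain ⟨q₀, hq₀, -⟩ := hbig 0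
  have hsub : Ici q₀ ⊆ I := fun q hq => by
    obtain ⟨q', hq', hlt⟩ := hbig q
    exact hI.out hq₀ hq' ⟨hq, hlt.le⟩
  have hint : ∀ q, q₀ < q → q ∈ interior I := fun q hq =>
    mem_interior_iff_mem_nhds.2 (Filter.mem_of_superset (Ici_mem_nhds hq) hsub)
  have hturn : ∀ q, q₀ + 1 ≤ q → Turn P q := by
    intro q hq
    obtain ⟨-, ε, hε, k, ℓ, hl, hr, hkl⟩ := hP q (hsub (show q₀ ≤ q by linarith))
    refine ⟨ℓ, k, ⟨min ε 1, by positivity, fun t ht => hl t ⟨hsub ?_, ?_, ht.2⟩⟩,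
      ⟨ε, hε, fun t ht => hr t ⟨hsub (show q₀ ≤ t by linarith [ht.1]), ht⟩⟩, ?_⟩
    · have := min_le_right ε 1
      exact show q₀ ≤ t by linarith [ht.1]
    · linarith [ht.1, min_le_left ε 1]
    · rcases lt_or_ge ℓ k with hlt | hge
      · exact (hkl (hint q (by linarith)) hlt k hlt.le le_rfl).le
      · exact (hpos q (hsub (show q₀ ≤ q by linarith))).2.1 hge
  have hunb : ∀ M, ∃ q, q₀ + 1 ≤ q ∧ M < P q 0 := fun M => by
    obtain ⟨q, hq, hM⟩ := hub (max M (q₀ + 1))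
    have := hpos q hq
    have h₀ := hM 0
    rw [max_lt_iff] at h₀
    exact ⟨q, by linarith [this.sum_eq, this.1 1, this.1 2], h₀.1⟩
  obtain ⟨T, hT, hT₀⟩ := hunb 0
  -- positivity of the first component persists since components do not decrease
  have hmono : ∀ q, T ≤ q → 0 < P q 0 := by
    intro q hq
    choose! k hk using fun q (hq : q₀ + 1 ≤ q) => hturn q hq
    choose! m hm using hk
    have := image_le_of_deriv_right_le_deriv_boundary (f := fun _ => P T 0) (f' := fun _ => 0)
      (B := fun q => P q 0) (a := T) (b := q)
      continuousOn_const (fun x _ => hasDerivWithinAt_const _ _ _) le_rfl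
      (fun x hx => ((continuous_apply (0 : Fin 3)).continuousAt.comp
        (hturn x (hT.trans hx.1)).continuousAt).continuousWithinAt)
      (fun x hx => (hm x (hT.trans hx.1)).2.1.hasDerivWithinAt 0)
      (fun x _ => eVec_nonneg _ _) ⟨hq, le_rfl⟩
    exact hT₀.trans_le this
  refine ⟨T, ⟨fun q hq => hpos q (hsub ?_), fun q hq => hturn q (hT.trans hq), hmono,
    fun M => ?_⟩, fun q hq => hsub ?_⟩
  · exact show q₀ ≤ q by linarith
  · obtain ⟨q, hq, hM⟩ := hub (max M T)
    have := hpos q hq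
    have h₀ := hM 0
    rw [max_lt_iff] at h₀
    exact ⟨q, by linarith [this.sum_eq, this.1 1, this.1 2], h₀.1⟩
  · exact show q₀ ≤ q by linarith [mem_Ioi.1 hq]

/-- A way to travel alternately along the systems `F false` and `F true`: the `n`-th journey goes
from `s n` to `t n` along `F n.bodd`, then follows a segment of slope `e_{k n}` and length `L n` up
to a multiple of the starting point of the next journey. -/
structure Splice (F : Bool → ℝ → RVec 3) (T : ℝ) where
  s : ℕ → ℝ
  t : ℕ → ℝ
  L : ℕ → ℝ
  μ : ℕ → ℝ
  k : ℕ → Fin 3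
  le_s : ∀ n, T ≤ s n
  nat_le_s : ∀ n : ℕ, n ≤ s n
  s_le_t : ∀ n, s n ≤ t n
  s_add_two_le_t : ∀ n, s (n + 2) ≤ t n
  L_nonneg : ∀ n, 0 ≤ L n
  μ_pos : ∀ n, 0 < μ n
  joins : ∀ n, μ n • (F n.bodd (t n) + L n • eVec 3 (k n)) =
    μ (n + 1) • F (n + 1).bodd (s (n + 1))
  growth : ∀ n, 2 * F n.bodd (s n) 0 ≤ F n.bodd (t n) 0
  leave : ∀ n, ∃ ℓ, SlopeL (F n.bodd) (t n) ℓ ∧ F n.bodd (t n) (k n) ≤ F n.bodd (t n) ℓ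
  arrive : ∀ n, ∃ m, SlopeR (F (n + 1).bodd) (s (n + 1)) m ∧
    F (n + 1).bodd (s (n + 1)) m ≤ F (n + 1).bodd (s (n + 1)) (k n)

lemma IsTail.nonempty_splice {F : Bool → ℝ → RVec 3} {T : ℝ} (hF : ∀ b, IsTail (F b) T) :
    Nonempty (Splice F T) := by
  have hcyc : ∀ b r, ∃ A B D C, T ≤ A ∧ r ≤ A ∧ PairCycle (F b) A B D C := fun b r => by
    obtain ⟨A, B, D, C, hA, h⟩ := (hF b).exists_cycle (le_max_left T r)
    exact ⟨A, B, D, C, (le_max_left _ _).trans hA, (le_max_right _ _).trans hA, h⟩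
  choose A B D C hTA hrA hc using hcyc
  have hAC : ∀ b r, A b r ≤ C b r := fun b r =>
    (hc b r).hAB.trans ((hc b r).hBD.trans (hc b r).hDC)
  choose M hM using fun (b : Bool) (r : ℝ) => (hF b).exists_lt r
  let r : ℕ → ℝ := fun n => max (M n.bodd (2 * F n.bodd (C n.bodd n) 0))
    (max (C n.bodd n) (C n.bodd (n + 2 : ℕ)))
  choose t ht s hs L lam k hL hlam hj hl hr using fun n : ℕ =>
    (hc n.bodd (r n)).exists_transition (hF _) (hF _) (hTA _ _) (hTA _ _)
      (hc (n + 1).bodd (n + 1 : ℕ))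
  let s' : ℕ → ℝ := fun n => Nat.casesOn n (A false 0) s
  have hs' : ∀ n : ℕ, s' n ∈ Icc (A n.bodd n) (C n.bodd n) := by
    rintro (_ | n)
    · simpa [s'] using hAC false 0
    · exact hs n
  have hrt : ∀ n, r n ≤ t n := fun n => (hrA _ _).trans (ht n).1
  have hCt : ∀ n : ℕ, C n.bodd n ≤ t n := fun n =>
    (le_max_left _ _).trans ((le_max_right _ _).trans (hrt n))
  have hCt' : ∀ n : ℕ, C n.bodd (n + 2 : ℕ) ≤ t n := fun n =>
    (le_max_right _ _).trans ((le_max_right _ _).trans (hrt n))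
  refine ⟨⟨s', t, L, fun n => ∏ i ∈ Finset.range n, lam i, k, fun n => (hTA _ _).trans (hs' n).1,
    fun n => (hrA _ _).trans (hs' n).1, fun n => (hs' n).2.trans (hCt n), fun n => ?_, hL,
    fun n => Finset.prod_pos fun i _ => hlam i, fun n => ?_, fun n => ?_, hl, hr⟩⟩
  · refine (hs' (n + 2)).2.trans ?_
    simpa using hCt' n
  · rw [Finset.prod_range_succ, mul_smul, hj n]
  · have h₁ := (hF n.bodd).mono ((hTA _ _).trans (hs' n).1) (hs' n).2 0
    have h₂ := hM n.bodd _ (t n) ((le_max_left _ _).trans (hrt n))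
    linarith

namespace Splice

variable {F : Bool → ℝ → RVec 3} {T : ℝ} (S : Splice F T)

/-- The transition times. -/
def x (n : ℕ) : ℝ := S.μ n * S.s n

/-- The `n`-th piece, before rescaling. -/
def R (n : ℕ) : ℝ → RVec 3 := follow (F n.bodd) (S.t n) (S.k n)

lemma le_t (n : ℕ) : T ≤ S.t n := (S.le_s n).trans (S.s_le_t n)

lemma x_succ (hF : ∀ b, IsTail (F b) T) (n : ℕ) : S.x (n + 1) = S.μ n * (S.t n + S.L n) := by
  have h := congrArg (fun v => ∑ i, v i) (S.joins n)
  have h₁ := ((hF n.bodd).position _ (S.le_t n)).2.2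
  have h₂ := ((hF (n + 1).bodd).position _ (S.le_s (n + 1))).2.2
  simp only [Pi.smul_apply, Pi.add_apply, smul_eq_mul, ← Finset.mul_sum, Finset.sum_add_distrib,
    sum_eVec, h₁, h₂, mul_one] at h
  exact h.symm

lemma R_end (n : ℕ) :
    S.R n (S.t n + S.L n) = F n.bodd (S.t n) + S.L n • eVec 3 (S.k n) := by
  rw [R, follow_of_ge (by linarith [S.L_nonneg n]), add_sub_cancel_left]

lemma s_lt_t (hF : ∀ b, IsTail (F b) T) (n : ℕ) : S.s n < S.t n := by
  refine (S.s_le_t n).lt_of_ne fun h => ?_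
  have h₁ := S.growth n
  have h₂ := (hF n.bodd).pos _ (S.le_s n)
  rw [← h] at h₁
  linarith

lemma x_lt_succ (hF : ∀ b, IsTail (F b) T) (n : ℕ) : S.x n < S.x (n + 1) := by
  rw [S.x_succ hF, x]
  exact mul_lt_mul_of_pos_left (by linarith [S.s_lt_t hF n, S.L_nonneg n]) (S.μ_pos n)

lemma tendsto_first (hF : ∀ b, IsTail (F b) T) :
    Tendsto (fun n => S.μ n * F n.bodd (S.s n) 0) atTop atTop := by
  have hstep : ∀ n, 2 * (S.μ n * F n.bodd (S.s n) 0) ≤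
      S.μ (n + 1) * F (n + 1).bodd (S.s (n + 1)) 0 := fun n => by
    have h := congrFun (S.joins n) 0
    simp only [Pi.smul_apply, Pi.add_apply, smul_eq_mul] at h
    rw [← h, mul_left_comm]
    exact mul_le_mul_of_nonneg_left (by
      linarith [S.growth n, mul_nonneg (S.L_nonneg n) (eVec_nonneg (S.k n) 0)]) (S.μ_pos n).le
  have h₀ : 0 < S.μ 0 * F (0 : ℕ).bodd (S.s 0) 0 :=
    mul_pos (S.μ_pos 0) ((hF _).pos _ (S.le_s 0))
  have hpow : ∀ n : ℕ, S.μ 0 * F (0 : ℕ).bodd (S.s 0) 0 * 2 ^ n ≤ S.μ n * F n.bodd (S.s n) 0 := by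
    intro n
    induction n with
    | zero => simp
    | succ n ih => rw [pow_succ]; linarith [hstep n]
  exact tendsto_atTop_mono hpow
    ((tendsto_pow_atTop_atTop_of_one_lt one_lt_two).const_mul_atTop h₀)

lemma tendsto_x (hF : ∀ b, IsTail (F b) T) : Tendsto S.x atTop atTop := by
  refine tendsto_atTop_mono (fun n => ?_) (S.tendsto_first hF)
  have h := (hF n.bodd).position _ (S.le_s n)
  exact mul_le_mul_of_nonneg_left (by linarith [h.sum_eq, h.1 1, h.1 2]) (S.μ_pos n).le

lemma R_s (n : ℕ) : S.R n (S.s n) = F n.bodd (S.s n) := follow_of_le (S.s_le_t n)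

lemma isPosition_R (hF : ∀ b, IsTail (F b) T) {n : ℕ} {y : ℝ}
    (hy : y ∈ Icc (S.s n) (S.t n + S.L n)) : IsPosition (S.R n y) y := by
  rcases le_total y (S.t n) with h | h
  · rw [R, follow_of_le h]
    exact (hF _).position y ((S.le_s n).trans hy.1)
  · rw [R, follow_of_ge h]
    have hm : Monotone (F n.bodd (S.t n) + S.L n • eVec 3 (S.k n)) := by
      have h₁ := (((hF (n + 1).bodd).position _ (S.le_s (n + 1))).smul (S.μ_pos (n + 1))).2.1
      rw [← S.joins n] at h₁
      intro i j hij
      exact le_of_mul_le_mul_left (h₁ hij) (S.μ_pos n)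
    have := ((hF n.bodd).position _ (S.le_t n)).segment hm (w := y - S.t n)
      ⟨by linarith, by linarith [hy.2]⟩
    rwa [add_sub_cancel] at this

lemma turn_R (hF : ∀ b, IsTail (F b) T) {n : ℕ} {y : ℝ} (hy : S.s n ≤ y) : Turn (S.R n) y :=
  turn_follow (fun _ => (hF _).turn y ((S.le_s n).trans hy)) (S.leave n)

lemma s_pos (hF : ∀ b, IsTail (F b) T) (n : ℕ) : 0 < S.s n := by
  have h := (hF n.bodd).position _ (S.le_s n)
  linarith [h.sum_eq, h.1 1, h.1 2, (hF n.bodd).pos _ (S.le_s n)]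

lemma direction_next (hF : ∀ b, IsTail (F b) T) (n : ℕ) :
    (S.s (n + 1))⁻¹ • F (n + 1).bodd (S.s (n + 1)) =
      (S.t n + S.L n)⁻¹ • (F n.bodd (S.t n) + S.L n • eVec 3 (S.k n)) := by
  have h₁ : S.μ (n + 1) * S.s (n + 1) = S.μ n * (S.t n + S.L n) := S.x_succ hF n
  have h₂ := S.joins n
  have hμ := (S.μ_pos n).ne'
  have hμ' := (S.μ_pos (n + 1)).ne'
  calc (S.s (n + 1))⁻¹ • F (n + 1).bodd (S.s (n + 1))
      = (S.μ (n + 1) * S.s (n + 1))⁻¹ • S.μ (n + 1) • F (n + 1).bodd (S.s (n + 1)) := by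
        rw [smul_smul, mul_inv_rev, inv_mul_cancel_right₀ hμ']
    _ = _ := by rw [← h₂, h₁, smul_smul, mul_inv_rev, inv_mul_cancel_right₀ hμ]

lemma direction_R (hF : ∀ b, IsTail (F b) T) {n : ℕ} {y : ℝ}
    (hy : y ∈ Icc (S.s n) (S.t n + S.L n)) :
    ∃ τ ≥ (n : ℝ), ∃ θ ∈ Icc (0 : ℝ) 1, y⁻¹ • S.R n y = (1 - θ) • τ⁻¹ • F n.bodd τ +
      θ • (S.s (n + 1))⁻¹ • F (n + 1).bodd (S.s (n + 1)) := by
  rcases le_or_gt y (S.t n) with h | h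
  · exact ⟨y, (S.nat_le_s n).trans hy.1, 0, by simp, by simp [R, follow_of_le h]⟩
  · have ht : 0 < S.t n := (S.s_pos hF n).trans (S.s_lt_t hF n)
    have hy₀ : 0 < y := ht.trans h
    have hL : 0 < S.L n := by linarith [hy.2]
    have htL : 0 < S.t n + S.L n := by linarith
    refine ⟨S.t n, (S.nat_le_s n).trans (S.s_le_t n),
      (y - S.t n) * (S.t n + S.L n) / (S.L n * y), ⟨?_, ?_⟩, ?_⟩
    · exact div_nonneg (mul_nonneg (by linarith) htL.le) (by positivity)
    · rw [div_le_one (by positivity)]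
      nlinarith [mul_nonneg ht.le (sub_nonneg.2 hy.2)]
    · rw [S.direction_next hF, R, follow_of_ge h.le]
      ext i
      simp only [Pi.smul_apply, Pi.add_apply, smul_eq_mul]
      field_simp
      ring

lemma exists_journey (b : Bool) (N : ℕ) :
    ∀ᶠ q in atTop, ∃ n ≥ N, n.bodd = b ∧ q ∈ Icc (S.s n) (S.t n) := by
  let c : ℕ := b.toNat
  have hs : Tendsto (fun j => S.s (2 * j + c)) atTop atTop :=
    tendsto_atTop_mono (fun j => (Nat.cast_le.2 (by omega)).trans (S.nat_le_s (2 * j + c)))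
      tendsto_natCast_atTop_atTop
  filter_upwards [eventually_gt_atTop (S.s (2 * N + c))] with q hq
  obtain ⟨j, hj, hqj⟩ := exists_mem_Ioc_of_tendsto hs (m := N) hq
  refine ⟨2 * j + c, by omega, ?_, hqj.1.le, hqj.2.trans ?_⟩
  · cases b <;> simp [c]
  · have := S.s_add_two_le_t (2 * j + c)
    rwa [show 2 * (j + 1) + c = 2 * j + c + 2 by ring]

/-- The pieces of a splice can be glued together to form a proper `3`-system. -/
lemma exists_system (hF : ∀ b, IsTail (F b) T) :
    ∃ P : ℝ → RVec 3, (∀ n, ∀ q ∈ Icc (S.x n) (S.x (n + 1)), P q = dilate (S.μ n) (S.R n) q) ∧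
      ∀ q, S.x 0 < q → IsPosition (P q) q ∧ Turn P q := by
  have hend : ∀ n, dilate (S.μ n) (S.R n) (S.x (n + 1)) =
      S.μ (n + 1) • F (n + 1).bodd (S.s (n + 1)) := fun n => by
    rw [S.x_succ hF, dilate_mul (S.μ_pos n), S.R_end, S.joins]
  have hstart : ∀ n, dilate (S.μ n) (S.R n) (S.x n) = S.μ n • F n.bodd (S.s n) := fun n => by
    rw [x, dilate_mul (S.μ_pos n), R_s]
  have hx := strictMono_nat_of_lt_succ (S.x_lt_succ hF)
  obtain ⟨P, hP⟩ := exists_glue hx (S.tendsto_x hF) (Q := fun n => dilate (S.μ n) (S.R n))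
    fun n => by rw [hend, hstart]
  refine ⟨P, hP, fun q hq => ?_⟩
  obtain ⟨n, -, hqn⟩ := exists_mem_Ioc_of_tendsto (S.tendsto_x hF) hq
  have hqn' := hqn
  have hlt := S.x_lt_succ hF n
  constructor
  · rw [hP n q ⟨hqn.1.le, hqn.2⟩]
    rw [S.x_succ hF] at hqn
    obtain ⟨y, hy, rfl⟩ := exists_mul_of_mem_Icc (S.μ_pos n) ⟨hqn.1.le, hqn.2⟩
    rw [dilate_mul (S.μ_pos n)]
    exact (S.isPosition_R hF hy).smul (S.μ_pos n)
  · rcases hqn.2.lt_or_eq with h | rfl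
    · refine Turn.congr (f := dilate (S.μ n) (S.R n)) ?_ ⟨hqn.1, h⟩ (hP n)
      rw [S.x_succ hF] at hqn
      obtain ⟨y, hy, rfl⟩ := exists_mul_of_mem_Icc (S.μ_pos n) ⟨hqn.1.le, hqn.2⟩
      exact (S.turn_R hF hy.1).dilate (S.μ_pos n)
    · obtain ⟨ℓ, hℓ, hle⟩ := exists_slopeL_follow
        (show S.t n ≤ S.t n + S.L n by linarith [S.L_nonneg n]) (S.leave n)
      obtain ⟨m, hm, hle'⟩ := S.arrive n
      have h₁ := hℓ.dilate (S.μ_pos n)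
      rw [← S.x_succ hF] at h₁
      have h₂ : SlopeR (S.R (n + 1)) (S.s (n + 1)) m :=
        hm.congr (S.s_lt_t hF (n + 1)) fun y hy => follow_of_le hy.2
      have hP₁ := hP n (S.x (n + 1)) ⟨hlt.le, le_rfl⟩
      refine ⟨ℓ, m, h₁.congr hlt (hP n), (h₂.dilate (S.μ_pos (n + 1))).congr
        (S.x_lt_succ hF (n + 1)) (hP (n + 1)), ?_⟩
      have e : P (S.x (n + 1)) = S.μ n • S.R n (S.t n + S.L n) := by
        rw [hP₁, S.x_succ hF, dilate_mul (S.μ_pos n)]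
      have e' : P (S.x (n + 1)) = S.μ (n + 1) • F (n + 1).bodd (S.s (n + 1)) := by
        rw [hP₁, hend]
      calc P (S.x (n + 1)) m ≤ P (S.x (n + 1)) (S.k n) := by
            rw [e']; exact mul_le_mul_of_nonneg_left hle' (S.μ_pos (n + 1)).le
        _ ≤ P (S.x (n + 1)) ℓ := by
            rw [e]; exact mul_le_mul_of_nonneg_left hle (S.μ_pos n).le

end Splice

lemma isProperSys_of_turn {P : ℝ → RVec 3} {a : ℝ} (ha : 0 ≤ a)
    (h : ∀ q, a < q → IsPosition (P q) q ∧ Turn P q) (hub : ∀ M, ∃ q, a < q ∧ M < P q 0) :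
    IsProperSys 3 (Ioi a) P := by
  refine ⟨⟨fun q hq => ha.trans (mem_Ioi.1 hq).le, ordConnected_Ioi, by simp, fun q hq =>
    ⟨(h q hq).1, ?_⟩⟩, fun M => ?_⟩
  · obtain ⟨ℓ, k, ⟨ε, hε, hl⟩, ⟨ε', hε', hr⟩, hle⟩ := (h q hq).2
    have hm := (h q hq).1.2.1
    refine ⟨min ε ε', lt_min hε hε', k, ℓ, fun t ht => hl t ⟨?_, ht.2.2⟩,
      fun t ht => hr t ⟨ht.2.1, ?_⟩, fun _ _ i hi hi' =>
        le_antisymm ((hm hi').trans hle) (hm hi)⟩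
    · linarith [ht.2.1, min_le_left ε ε']
    · linarith [ht.2.2, min_le_right ε ε']
  · obtain ⟨q, hq, hM⟩ := hub M
    exact ⟨q, hq, fun i => hM.trans_le ((h q hq).1.zero_le i)⟩

lemma inv_mul_smul_smul {μ : ℝ} (hμ : 0 < μ) (q : ℝ) (v : RVec 3) :
    (μ * q)⁻¹ • μ • v = q⁻¹ • v := by
  rw [smul_smul, mul_inv_rev, inv_mul_cancel_right₀ hμ.ne']

/-- **Theorem (convex hulls in dimension 3).** For any proper `3`-systems
`P⁽¹⁾, P⁽²⁾`, there is a proper `3`-system `P` with `K(P)` equal to the convex hull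
of `K(P⁽¹⁾) ∪ K(P⁽²⁾)` (where `K(·)` is the convex hull of `F(·)`). -/
theorem hull_of_union_3systems (I₁ I₂ : Set ℝ) (P₁ P₂ : ℝ → RVec 3)
    (h₁ : IsProperSys 3 I₁ P₁) (h₂ : IsProperSys 3 I₂ P₂) :
    ∃ (J : Set ℝ) (P : ℝ → RVec 3), IsProperSys 3 J P ∧
      convexHull ℝ (FSet 3 J P) =
        convexHull ℝ (convexHull ℝ (FSet 3 I₁ P₁) ∪ convexHull ℝ (FSet 3 I₂ P₂)) := by
  obtain ⟨T₁, hT₁, hI₁⟩ := h₁.exists_isTail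
  obtain ⟨T₂, hT₂, hI₂⟩ := h₂.exists_isTail
  let F : Bool → ℝ → RVec 3 := fun b => bif b then P₂ else P₁
  have hF : ∀ b, IsTail (F b) (max T₁ T₂) := by
    rintro (_ | _)
    · exact hT₁.of_le (le_max_left _ _)
    · exact hT₂.of_le (le_max_right _ _)
  obtain ⟨S⟩ := IsTail.nonempty_splice hF
  obtain ⟨P, hP, hP'⟩ := S.exists_system hF
  have hx := strictMono_nat_of_lt_succ (S.x_lt_succ hF)
  have hjourney : ∀ (b : Bool) (N : ℝ), ∀ᶠ q in atTop, ∃ q' ≥ N, q'⁻¹ • P q' = q⁻¹ • F b q := by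
    intro b N
    obtain ⟨m, hm⟩ := ((S.tendsto_x hF).eventually_ge_atTop N).exists
    filter_upwards [S.exists_journey b m] with q hq
    obtain ⟨n, hn, rfl, hq⟩ := hq
    have hge : S.x n ≤ S.μ n * q := mul_le_mul_of_nonneg_left hq.1 (S.μ_pos n).le
    refine ⟨S.μ n * q, hm.trans ((hx.monotone hn).trans hge), ?_⟩
    rw [hP n _ ⟨hge, ?_⟩, dilate_mul (S.μ_pos n), inv_mul_smul_smul (S.μ_pos n), Splice.R,
      follow_of_le hq.2]
    rw [S.x_succ hF]
    exact mul_le_mul_of_nonneg_left (by linarith [hq.2, S.L_nonneg n]) (S.μ_pos n).le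
  refine ⟨Ioi (S.x 0), P, isProperSys_of_turn (mul_pos (S.μ_pos 0) (S.s_pos hF 0)).le hP' ?_, ?_⟩
  · intro M
    obtain ⟨n, hn, hn'⟩ := (((S.tendsto_first hF).eventually_gt_atTop M).and
      (eventually_gt_atTop 0)).exists
    refine ⟨S.x n, hx hn', ?_⟩
    rw [hP n _ ⟨le_rfl, (S.x_lt_succ hF n).le⟩, Splice.x, dilate_mul (S.μ_pos n), S.R_s]
    exact hn
  · have e₀ : FSet 3 (Ioi (S.x 0)) P = {x | IsLimitPoint P x} :=
      Set.ext fun x => mem_FSet_iff Subset.rfl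
    have e₁ : FSet 3 I₁ P₁ = {x | IsLimitPoint P₁ x} := Set.ext fun x => mem_FSet_iff hI₁
    have e₂ : FSet 3 I₂ P₂ = {x | IsLimitPoint P₂ x} := Set.ext fun x => mem_FSet_iff hI₂
    rw [e₀, e₁, e₂]
    refine convexHull_limitPoints hT₁ hT₂ (fun N => ?_) (hjourney false) (hjourney true)
    obtain ⟨m, hm⟩ := exists_nat_ge N
    filter_upwards [eventually_gt_atTop (S.x m)] with q hq
    obtain ⟨n, hn, hqn⟩ := exists_mem_Ioc_of_tendsto (S.tendsto_x hF) hq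
    have hPq := hP n q ⟨hqn.1.le, hqn.2⟩
    rw [S.x_succ hF] at hqn
    obtain ⟨y, hy, rfl⟩ := exists_mul_of_mem_Icc (S.μ_pos n) ⟨hqn.1.le, hqn.2⟩
    obtain ⟨τ, hτ, θ, hθ, he⟩ := S.direction_R hF hy
    rw [hPq, dilate_mul (S.μ_pos n), inv_mul_smul_smul (S.μ_pos n), he]
    have hNn : N ≤ n := hm.trans (Nat.cast_le.2 hn)
    have hs : N ≤ S.s (n + 1) :=
      hNn.trans ((Nat.cast_le.2 (Nat.le_succ n)).trans (S.nat_le_s (n + 1)))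
    rw [Nat.bodd_succ]
    cases hb : n.bodd
    · exact ⟨τ, hNn.trans hτ, _, hs, θ, hθ, rfl⟩
    · exact ⟨_, hs, τ, hNn.trans hτ, 1 - θ, ⟨sub_nonneg.2 hθ.2, by linarith [hθ.1]⟩,
        by rw [sub_sub_cancel, add_comm]; rfl⟩
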